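/- For the hyperoctahedral group B_{2n}^2 with n ≥ 5, in its center: C_{((1^{n−2}),(2))} · C_{((1^{n−2}),(2))} = n(n−1) C_{((1^n),∅)} + 2 C_{((1^{n−2}),(1²))} + 2 C_{((1^{n−4}),(2²))} + 3 C_{((1^{n−3},3),∅)}. -/

import Mathlib

open Equiv Finset

namespace KWr

/-- The `i`-th block `p_k(i)` (0-indexed): elements `x ∈ [kn]` with `x / k = i`. -/
def pk (k n : ℕ) (i : ℕ) : Finset (Fin (k * n)) :=
  Finset.univ.filter (fun x => (x : ℕ) / k = i)

/-- `w` maps every block onto some block. -/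
def IsBlockPerm (k n : ℕ) (w : Perm (Fin (k * n))) : Prop :=
  ∀ i : Fin n, ∃ j : Fin n, (pk k n (i : ℕ)).image w = pk k n (j : ℕ)

theorem isBlockPerm_one (k n : ℕ) : IsBlockPerm k n 1 := fun i =>
  ⟨i, by simp [pk]⟩

theorem isBlockPerm_mul (k n : ℕ) {a b : Perm (Fin (k * n))}
    (ha : IsBlockPerm k n a) (hb : IsBlockPerm k n b) : IsBlockPerm k n (a * b) := by
  intro i
  obtain ⟨j, hj⟩ := hb i
  obtain ⟨l, hl⟩ := ha j
  refine ⟨l, ?_⟩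
  rw [← hl, ← hj, Finset.image_image]
  rfl

theorem isBlockPerm_pow (k n : ℕ) {a : Perm (Fin (k * n))} (ha : IsBlockPerm k n a) :
    ∀ m : ℕ, IsBlockPerm k n (a ^ m) := by
  intro m
  induction m with
  | zero => simpa using isBlockPerm_one k n
  | succ m ih => rw [pow_succ]; exact isBlockPerm_mul k n ih ha

/-- The group `B_{kn}^k` of block permutations, as a subgroup of `S_{kn}`. -/
def Bgrp (k n : ℕ) : Subgroup (Perm (Fin (k * n))) where
  carrier := {w | IsBlockPerm k n w}
  one_mem' := isBlockPerm_one k n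
  mul_mem' := fun ha hb => isBlockPerm_mul k n ha hb
  inv_mem' := by
    intro a ha
    have ho : 0 < orderOf a := orderOf_pos a
    have h1 : a⁻¹ = a ^ (orderOf a - 1) := by
      have h : a ^ (orderOf a - 1) * a = 1 := by
        rw [← pow_succ, Nat.sub_add_cancel ho, pow_orderOf_eq_one]
      exact inv_eq_of_mul_eq_one_left h
    show IsBlockPerm k n a⁻¹
    rw [h1]
    exact isBlockPerm_pow k n ha _

/-- The first element of the `i`-th block. -/
def elemIn (k n : ℕ) (hk : 0 < k) (i : Fin n) : Fin (k * n) :=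
  ⟨(i : ℕ) * k, by
    calc (i : ℕ) * k < n * k := by
          exact Nat.mul_lt_mul_of_lt_of_le i.2 (le_refl k) hk
      _ = k * n := Nat.mul_comm n k⟩

/-- The map induced by `w` on block indices. -/
def blockMap (k n : ℕ) (hk : 0 < k) (w : Perm (Fin (k * n))) (i : Fin n) : Fin n :=
  ⟨((w (elemIn k n hk i)) : ℕ) / k, by
    refine (Nat.div_lt_iff_lt_mul hk).mpr ?_
    calc ((w (elemIn k n hk i)) : ℕ) < k * n := (w (elemIn k n hk i)).2
      _ = n * k := Nat.mul_comm k n⟩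

/-- The permutation `p_w` of block indices induced by a block permutation `w`. -/
noncomputable def pPerm (k n : ℕ) (hk : 0 < k) (w : Perm (Fin (k * n))) : Perm (Fin n) :=
  if h : Function.Bijective (blockMap k n hk w) then Equiv.ofBijective _ h else 1

/-- Length of the cycle of `i` under `p`. -/
noncomputable def cycLen {n : ℕ} (p : Perm (Fin n)) (i : Fin n) : ℕ := Function.minimalPeriod p i

/-- The `a`-th element of the `i`-th block. -/
def inBlock (k n : ℕ) (hk : 0 < k) (i : Fin n) (a : Fin k) : Fin (k * n) :=
  ⟨(i : ℕ) * k + (a : ℕ), by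
    calc (i : ℕ) * k + (a : ℕ) < (i : ℕ) * k + k := Nat.add_lt_add_left a.2 _
      _ = ((i : ℕ) + 1) * k := by ring
      _ ≤ n * k := Nat.mul_le_mul_right k i.2
      _ = k * n := Nat.mul_comm n k⟩

/-- The cycle product of `w` at the block `i`: the return map of `w` on the block `i`,
viewed as a permutation of `Fin k`. -/
noncomputable def cycProd (k n : ℕ) (hk : 0 < k) (w : Perm (Fin (k * n))) (i : Fin n) :
    Perm (Fin k) :=
  if h : Function.Bijective (fun a : Fin k =>
      (⟨((w ^ cycLen (pPerm k n hk w) i) (inBlock k n hk i a) : ℕ) % k,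
        Nat.mod_lt _ hk⟩ : Fin k))
  then Equiv.ofBijective _ h else 1

/-- The partition `(1^k)` of `k`. -/
def onePartition (k : ℕ) : Nat.Partition k where
  parts := Multiset.replicate k 1
  parts_pos := fun {i} hi => by rw [Multiset.eq_of_mem_replicate hi]; exact one_pos
  parts_sum := by simp

-- The type of a block permutation `w` of `[kn]`: for each partition `ρ` of `k`, the
-- multiset `tyFam k n hk w ρ` collects, over all cycles of the induced block permutation
-- `p_w` whose cycle product has cycle type `ρ`, the length of the cycle.
open scoped Classical in
noncomputable def tyFam (k n : ℕ) (hk : 0 < k) (w : Perm (Fin (k * n)))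
    (ρ : Nat.Partition k) : Multiset ℕ :=
  (Finset.univ.filter (fun i : Fin n =>
      (∀ j : Fin n, (pPerm k n hk w).SameCycle i j → i ≤ j) ∧
      (cycProd k n hk w i).partition.parts = ρ.parts)).val.map
    (fun i => cycLen (pPerm k n hk w) i)

/-- Total size of a family of partitions indexed by the partitions of `k`. -/
noncomputable def famSize (k : ℕ) (Λ : Nat.Partition k → Multiset ℕ) : ℕ :=
  ∑ ρ : Nat.Partition k, (Λ ρ).sum

-- Complete a family of partitions `Λ` to total size `n` by adding parts `1`
-- to the component indexed by `(1^k)`.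
open scoped Classical in
noncomputable def ExtFam (k n : ℕ) (Λ : Nat.Partition k → Multiset ℕ) :
    Nat.Partition k → Multiset ℕ := fun ρ =>
  if ρ = onePartition k then Λ ρ + Multiset.replicate (n - famSize k Λ) 1 else Λ ρ

/-- `z_λ = ∏ r, r^{m_r(λ)} m_r(λ)!` for a partition given as a multiset of parts. -/
def zOf (m : Multiset ℕ) : ℕ :=
  ∏ r ∈ m.toFinset, r ^ m.count r * Nat.factorial (m.count r)

/-- `Z_Λ = ∏_{λ ⊢ k} z_{Λ(λ)} z_λ^{l(Λ(λ))}`. -/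
noncomputable def ZFam (k : ℕ) (Λ : Nat.Partition k → Multiset ℕ) : ℕ :=
  ∏ ρ : Nat.Partition k, zOf (Λ ρ) * zOf ρ.parts ^ (Multiset.card (Λ ρ))

/-- A `k`-partial permutation of `n`, encoded as a pair `(s, w)` where `s` is the set of
block indices of `d` and `w` is the extension of `ω` to `[kn]` by the identity:
`w` is a block permutation fixing pointwise every block outside `s`. -/
def IsKPP (k n : ℕ) (pr : Finset (Fin n) × Perm (Fin (k * n))) : Prop :=
  IsBlockPerm k n pr.2 ∧
    ∀ x : Fin (k * n), (¬ ∃ i ∈ pr.1, (x : ℕ) / k = (i : ℕ)) → pr.2 x = x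

/-- The set of `k`-partial permutations of `n`. -/
def KPP (k n : ℕ) : Type := {pr : Finset (Fin n) × Perm (Fin (k * n)) // IsKPP k n pr}

/-- The action `σ · (d, ω) = (σ(d), σωσ⁻¹)` on (the underlying data of)
`k`-partial permutations. -/
noncomputable def actKPP (k n : ℕ) (hk : 0 < k) (σ : Perm (Fin (k * n)))
    (pr : Finset (Fin n) × Perm (Fin (k * n))) : Finset (Fin n) × Perm (Fin (k * n)) :=
  (pr.1.image (fun i => pPerm k n hk σ i), σ * pr.2 * σ⁻¹)

/-- A `k`-partial permutation `(d, ω)` has type `Λ` (a family of partitions indexed by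
the partitions of `k`) iff `d` consists of `|Λ|` blocks and the type of `ω` is `Λ`;
in terms of the global extension `w`, the type of `w` is `Λ` completed with
`n - |Λ|` parts equal to `1` in the component `(1^k)`. -/
def HasTypeKPP (k n : ℕ) (hk : 0 < k) (p : KPP k n)
    (Λ : Nat.Partition k → Multiset ℕ) : Prop :=
  p.val.1.card = famSize k Λ ∧ ∀ ρ, tyFam k n hk p.val.2 ρ = ExtFam k n Λ ρ

/-- `deg₁(d, ω)`: the number of blocks of `d` plus the number of blocks of `d` on which
`ω` acts as the identity. -/
def deg1 (k n : ℕ) (pr : Finset (Fin n) × Perm (Fin (k * n))) : ℕ :=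
  pr.1.card +
    (pr.1.filter (fun i : Fin n => ∀ x : Fin (k * n), (x : ℕ) / k = (i : ℕ) → pr.2 x = x)).card


/-- The automorphism of `S_k^n` permuting coordinates by `σ`. -/
def permCoordAut (k n : ℕ) (σ : Perm (Fin n)) : MulAut (Fin n → Perm (Fin k)) where
  toFun f := f ∘ σ.symm
  invFun f := f ∘ σ
  left_inv f := by funext i; simp
  right_inv f := by funext i; simp
  map_mul' f g := rfl

/-- The action of `S_n` on `S_k^n` permuting coordinates, as a homomorphism. -/
def permCoordHom (k n : ℕ) : Perm (Fin n) →* MulAut (Fin n → Perm (Fin k)) where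
  toFun := permCoordAut k n
  map_one' := by apply MulEquiv.ext; intro f; rfl
  map_mul' σ τ := by apply MulEquiv.ext; intro f; rfl

-- The class sum, in the group algebra of `S_n`, of the permutations of cycle type `m`.
open scoped Classical in
noncomputable def CS (n : ℕ) (m : Multiset ℕ) : MonoidAlgebra ℂ (Perm (Fin n)) :=
  ∑ σ ∈ Finset.univ.filter (fun σ : Perm (Fin n) => σ.partition.parts = m),
    MonoidAlgebra.of ℂ (Perm (Fin n)) σ

theorem twoPos : (0 : ℕ) < 2 := by norm_num

-- The class sum, in the group algebra of the hyperoctahedral group `B_{2n}^2`, of the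
-- conjugacy class indexed by the bipartition `(l1, l2)` of `n`, where `l1` corresponds
-- to the partition `(1,1)` of `2` and `l2` to the partition `(2)`.
open scoped Classical in
noncomputable def CB (n : ℕ) (l1 l2 : Multiset ℕ) : MonoidAlgebra ℂ (Bgrp 2 n) :=
  ∑ w ∈ Finset.univ.filter (fun w : Bgrp 2 n =>
      tyFam 2 n twoPos (w : Perm (Fin (2 * n))) (onePartition 2) = l1 ∧
      tyFam 2 n twoPos (w : Perm (Fin (2 * n))) (Nat.Partition.indiscrete 2) = l2),
    MonoidAlgebra.of ℂ (Bgrp 2 n) w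



section
variable {n : ℕ}

/-- The sign of `w` at the block `i`: the position, inside its block, of the image of the first
element of the block `i`. -/
def flip (w : Perm (Fin (2 * n))) (i : Fin n) : Fin 2 :=
  ⟨(w (inBlock 2 n twoPos i 0) : ℕ) % 2, Nat.mod_lt _ twoPos⟩

theorem inBlock_two_inj {i j : Fin n} {a b : Fin 2} :
    inBlock 2 n twoPos i a = inBlock 2 n twoPos j b ↔ i = j ∧ a = b := by
  simp only [inBlock, Fin.ext_iff]
  omega

theorem inBlock_two_div_mod (x : Fin (2 * n)) :
    inBlock 2 n twoPos ⟨x / 2, by omega⟩ ⟨x % 2, Nat.mod_lt _ twoPos⟩ = x := by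
  simp only [inBlock, Fin.ext_iff]
  omega

theorem exists_eq_inBlock (x : Fin (2 * n)) : ∃ i a, x = inBlock 2 n twoPos i a :=
  ⟨_, _, (inBlock_two_div_mod x).symm⟩

theorem inBlock_div (i : Fin n) (a : Fin 2) :
    (⟨(inBlock 2 n twoPos i a : ℕ) / 2, by omega⟩ : Fin n) = i := by
  simp only [inBlock, Fin.ext_iff]
  omega

theorem inBlock_mod (i : Fin n) (a : Fin 2) :
    (⟨(inBlock 2 n twoPos i a : ℕ) % 2, Nat.mod_lt _ twoPos⟩ : Fin 2) = a := by
  simp only [inBlock, Fin.ext_iff]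
  omega

theorem blockMap_eq_of_apply {w : Perm (Fin (2 * n))} (hw : IsBlockPerm 2 n w) (i : Fin n)
    (a : Fin 2) : (w (inBlock 2 n twoPos i a) : ℕ) / 2 = blockMap 2 n twoPos w i := by
  obtain ⟨j, hj⟩ := hw i
  have key (b : Fin 2) : (w (inBlock 2 n twoPos i b) : ℕ) / 2 = j := by
    have h : w (inBlock 2 n twoPos i b) ∈ pk 2 n j := by
      rw [← hj]
      refine mem_image_of_mem _ ?_
      simp only [pk, inBlock, mem_filter, mem_univ, true_and]
      omega
    simpa [pk] using h
  rw [key a]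
  exact (key 0).symm

theorem apply_inBlock_blockMap {w : Perm (Fin (2 * n))} (hw : IsBlockPerm 2 n w) (i : Fin n)
    (a : Fin 2) : w (inBlock 2 n twoPos i a) =
      inBlock 2 n twoPos (blockMap 2 n twoPos w i) (a + flip w i) := by
  have h0 := blockMap_eq_of_apply hw i 0
  have h1 := blockMap_eq_of_apply hw i 1
  have hne : (w (inBlock 2 n twoPos i 0) : ℕ) ≠ w (inBlock 2 n twoPos i 1) := by
    intro h
    have := w.injective (Fin.ext h)
    simp [inBlock_two_inj] at this
  fin_cases a
  · simp only [Fin.ext_iff, inBlock, flip] at *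
    simp at *
    omega
  · simp only [Fin.ext_iff, inBlock, flip] at *
    simp [Fin.val_add] at *
    omega

theorem pPerm_apply {w : Perm (Fin (2 * n))} (hw : IsBlockPerm 2 n w) (i : Fin n) :
    pPerm 2 n twoPos w i = blockMap 2 n twoPos w i := by
  have hs : Function.Surjective (blockMap 2 n twoPos w) := fun j => by
    have h := apply_inBlock_blockMap hw ⟨(w.symm (inBlock 2 n twoPos j 0) : ℕ) / 2, by omega⟩
      ⟨(w.symm (inBlock 2 n twoPos j 0) : ℕ) % 2, Nat.mod_lt _ twoPos⟩
    rw [inBlock_two_div_mod, apply_symm_apply, inBlock_two_inj] at h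
    exact ⟨_, h.1.symm⟩
  rw [pPerm, dif_pos (Finite.surjective_iff_bijective.mp hs)]
  rfl

theorem apply_inBlock {w : Perm (Fin (2 * n))} (hw : IsBlockPerm 2 n w) (i : Fin n)
    (a : Fin 2) : w (inBlock 2 n twoPos i a) =
      inBlock 2 n twoPos (pPerm 2 n twoPos w i) (a + flip w i) := by
  rw [apply_inBlock_blockMap hw, pPerm_apply hw]

theorem pPerm_flip_of_apply {w : Perm (Fin (2 * n))} (hw : IsBlockPerm 2 n w) {i j : Fin n}
    {c : Fin 2} (h : w (inBlock 2 n twoPos i 0) = inBlock 2 n twoPos j c) :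
    pPerm 2 n twoPos w i = j ∧ flip w i = c := by
  simpa [apply_inBlock hw, inBlock_two_inj] using h

theorem pPerm_flip_mul {a b : Perm (Fin (2 * n))} (ha : IsBlockPerm 2 n a)
    (hb : IsBlockPerm 2 n b) (i : Fin n) :
    pPerm 2 n twoPos (a * b) i = pPerm 2 n twoPos a (pPerm 2 n twoPos b i) ∧
      flip (a * b) i = flip b i + flip a (pPerm 2 n twoPos b i) :=
  pPerm_flip_of_apply (isBlockPerm_mul 2 n ha hb) (by
    rw [Perm.mul_apply, apply_inBlock hb, apply_inBlock ha, zero_add])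

theorem blockPerm_ext {a b : Perm (Fin (2 * n))} (ha : IsBlockPerm 2 n a)
    (hb : IsBlockPerm 2 n b) (hp : ∀ i, pPerm 2 n twoPos a i = pPerm 2 n twoPos b i)
    (hf : ∀ i, flip a i = flip b i) : a = b := by
  ext1 x
  rw [← inBlock_two_div_mod x, apply_inBlock ha, apply_inBlock hb, hp, hf]

theorem pow_apply_inBlock {w : Perm (Fin (2 * n))} (hw : IsBlockPerm 2 n w) (i : Fin n)
    (a : Fin 2) (m : ℕ) : (w ^ m) (inBlock 2 n twoPos i a) =
      inBlock 2 n twoPos ((pPerm 2 n twoPos w)^[m] i)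
        (a + ∑ t ∈ range m, flip w ((pPerm 2 n twoPos w)^[t] i)) := by
  induction m with
  | zero => simp
  | succ m ih =>
    rw [pow_succ', Perm.mul_apply, ih, apply_inBlock hw, sum_range_succ, add_assoc,
      Function.iterate_succ_apply']

/-- The total sign of `w` along the cycle of the block `i`. -/
noncomputable def cycFlip (w : Perm (Fin (2 * n))) (i : Fin n) : Fin 2 :=
  ∑ t ∈ range (cycLen (pPerm 2 n twoPos w) i), flip w ((pPerm 2 n twoPos w)^[t] i)

theorem cycProd_eq {w : Perm (Fin (2 * n))} (hw : IsBlockPerm 2 n w) (i : Fin n) :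
    cycProd 2 n twoPos w i = Equiv.addRight (cycFlip w i) := by
  have h : (fun a : Fin 2 =>
      (⟨((w ^ cycLen (pPerm 2 n twoPos w) i) (inBlock 2 n twoPos i a) : ℕ) % 2,
        Nat.mod_lt _ twoPos⟩ : Fin 2)) = Equiv.addRight (cycFlip w i) := by
    funext a
    rw [pow_apply_inBlock hw]
    simp only [inBlock, Fin.ext_iff, coe_addRight, cycFlip]
    omega
  rw [cycProd, dif_pos (by rw [h]; exact Equiv.bijective _)]
  ext1 a
  exact congrFun h a

theorem cycProd_parts {w : Perm (Fin (2 * n))} (hw : IsBlockPerm 2 n w) (i : Fin n) :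
    (cycProd 2 n twoPos w i).partition.parts = if cycFlip w i = 0 then {1, 1} else {2} := by
  rw [cycProd_eq hw]
  generalize cycFlip w i = c
  fin_cases c
  · have : Equiv.addRight (0 : Fin 2) = 1 := by ext; simp
    simp [this, Perm.parts_partition]
  · have : Equiv.addRight (1 : Fin 2) = swap 0 1 := by decide
    have hc : Perm.IsSwap (swap (0 : Fin 2) 1) := ⟨0, 1, by decide, rfl⟩
    simp [this, Perm.parts_partition, hc.isCycle.cycleType]

/-- `i` is the least element of its cycle under `p`. -/
def IsLeast (p : Perm (Fin n)) (i : Fin n) : Prop := ∀ j, p.SameCycle i j → i ≤ j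

open scoped Classical in
/-- The least elements of the cycles of `w` with cycle product the translation by `c`. -/
noncomputable def reps (w : Perm (Fin (2 * n))) (c : Fin 2) : Finset (Fin n) :=
  univ.filter fun i => IsLeast (pPerm 2 n twoPos w) i ∧ cycFlip w i = c

theorem mem_reps {w : Perm (Fin (2 * n))} {c : Fin 2} {i : Fin n} :
    i ∈ reps w c ↔ IsLeast (pPerm 2 n twoPos w) i ∧ cycFlip w i = c := by
  simp [reps]

theorem tyFam_two {w : Perm (Fin (2 * n))} (hw : IsBlockPerm 2 n w) (ρ : Nat.Partition 2)
    (c : Fin 2) (hρ : ρ.parts = if c = 0 then {1, 1} else {2}) :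
    tyFam 2 n twoPos w ρ = (reps w c).val.map (cycLen (pPerm 2 n twoPos w)) := by
  unfold tyFam
  congr 2
  ext i
  simp only [mem_filter, mem_univ, true_and, mem_reps, IsLeast, cycProd_parts hw, hρ]
  generalize cycFlip w i = d
  suffices h : ((if d = 0 then {1, 1} else {2} : Multiset ℕ) = if c = 0 then {1, 1} else {2}) ↔
    d = c by rw [h]
  clear hρ
  revert c d
  decide

/-- The block permutation with induced permutation `p` of the blocks and signs `s`. -/
def ofSigns (p : Perm (Fin n)) (s : Fin n → Fin 2) : Perm (Fin (2 * n)) where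
  toFun x := inBlock 2 n twoPos (p ⟨x / 2, by omega⟩)
    (⟨x % 2, Nat.mod_lt _ twoPos⟩ + s ⟨x / 2, by omega⟩)
  invFun x := inBlock 2 n twoPos (p.symm ⟨x / 2, by omega⟩)
    (⟨x % 2, Nat.mod_lt _ twoPos⟩ - s (p.symm ⟨x / 2, by omega⟩))
  left_inv x := by
    obtain ⟨i, a, rfl⟩ := exists_eq_inBlock x
    simp only [inBlock_div, inBlock_mod, symm_apply_apply, add_sub_cancel_right]
  right_inv x := by
    obtain ⟨i, a, rfl⟩ := exists_eq_inBlock x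
    simp only [inBlock_div, inBlock_mod, apply_symm_apply, sub_add_cancel]

theorem ofSigns_inBlock (p : Perm (Fin n)) (s : Fin n → Fin 2) (i : Fin n) (a : Fin 2) :
    ofSigns p s (inBlock 2 n twoPos i a) = inBlock 2 n twoPos (p i) (a + s i) := by
  simp only [ofSigns, coe_fn_mk, inBlock_div, inBlock_mod]

theorem isBlockPerm_ofSigns (p : Perm (Fin n)) (s : Fin n → Fin 2) :
    IsBlockPerm 2 n (ofSigns p s) := by
  refine fun i => ⟨p i, ?_⟩
  ext y
  obtain ⟨j, b, rfl⟩ := exists_eq_inBlock y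
  simp only [mem_image, pk, mem_filter, mem_univ, true_and]
  constructor
  · rintro ⟨x, hx, hxy⟩
    obtain ⟨k, a, rfl⟩ := exists_eq_inBlock x
    rw [ofSigns_inBlock, inBlock_two_inj] at hxy
    have hk : k = i := by
      rw [← inBlock_div k a]
      exact Fin.ext hx
    rw [← hxy.1, hk]
    exact Fin.ext_iff.mp (inBlock_div _ _)
  · intro h
    have hj : j = p i := by
      rw [← inBlock_div j b]
      exact Fin.ext h
    refine ⟨inBlock 2 n twoPos i (b - s i), Fin.ext_iff.mp (inBlock_div _ _), ?_⟩
    rw [ofSigns_inBlock, hj, sub_add_cancel]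

theorem pPerm_flip_ofSigns (p : Perm (Fin n)) (s : Fin n → Fin 2) (i : Fin n) :
    pPerm 2 n twoPos (ofSigns p s) i = p i ∧ flip (ofSigns p s) i = s i :=
  pPerm_flip_of_apply (isBlockPerm_ofSigns p s) (by rw [ofSigns_inBlock, zero_add])

/-- The element of the hyperoctahedral group with induced permutation `swap i j` of the blocks,
preserving the order of each block but `j`. -/
def negSwap (i j : Fin n) : Bgrp 2 n :=
  ⟨ofSigns (swap i j) (Pi.single j 1), isBlockPerm_ofSigns _ _⟩

theorem sameCycle_induction {p : Perm (Fin n)} {P : Fin n → Prop} (h : ∀ i, P i → P (p i))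
    {x j : Fin n} (hx : P x) (hj : p.SameCycle x j) : P j := by
  obtain ⟨m, -, -, rfl⟩ := hj.exists_pow_eq'
  clear hj
  induction m with
  | zero => simpa
  | succ m ih => rw [pow_succ', Perm.mul_apply]; exact h _ ih

theorem isLeast_of_fixed {p : Perm (Fin n)} {i : Fin n} (h : p i = i) : IsLeast p i :=
  fun _ hj => (sameCycle_induction (P := fun j => i = j) (by rintro _ rfl; exact h.symm)
    rfl hj).le

theorem not_isLeast_of_lt {p : Perm (Fin n)} {i : Fin n} (h : p i < i) : ¬ IsLeast p i :=
  fun hi => h.not_ge (hi _ (Perm.sameCycle_apply_right.mpr (Perm.SameCycle.refl p i)))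

theorem cycLen_eq_one_iff {p : Perm (Fin n)} {i : Fin n} : cycLen p i = 1 ↔ p i = i :=
  Function.minimalPeriod_eq_one_iff_isFixedPt

theorem cycLen_eq_two_iff {p : Perm (Fin n)} {i : Fin n} :
    cycLen p i = 2 ↔ p i ≠ i ∧ p (p i) = i := by
  refine ⟨fun h => ⟨fun h' => ?_, ?_⟩, fun h => ?_⟩
  · rw [← cycLen_eq_one_iff] at h'
    omega
  · have := Function.iterate_minimalPeriod (f := p) (x := i)
    rwa [show Function.minimalPeriod p i = 2 from h] at this
  · have : Fact (Nat.Prime 2) := ⟨Nat.prime_two⟩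
    exact Function.minimalPeriod_eq_prime h.2 h.1

theorem cycLen_eq_three_iff {p : Perm (Fin n)} {i : Fin n} :
    cycLen p i = 3 ↔ p i ≠ i ∧ p (p (p i)) = i := by
  refine ⟨fun h => ⟨fun h' => ?_, ?_⟩, fun h => ?_⟩
  · rw [← cycLen_eq_one_iff] at h'
    omega
  · have := Function.iterate_minimalPeriod (f := p) (x := i)
    rwa [show Function.minimalPeriod p i = 3 from h] at this
  · have : Fact (Nat.Prime 3) := ⟨Nat.prime_three⟩
    exact Function.minimalPeriod_eq_prime h.2 h.1

theorem cycFlip_of_cycLen_eq_one {w : Perm (Fin (2 * n))} {i : Fin n}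
    (h : cycLen (pPerm 2 n twoPos w) i = 1) : cycFlip w i = flip w i := by
  simp [cycFlip, h]

theorem cycFlip_of_cycLen_eq_two {w : Perm (Fin (2 * n))} {i : Fin n}
    (h : cycLen (pPerm 2 n twoPos w) i = 2) :
    cycFlip w i = flip w i + flip w (pPerm 2 n twoPos w i) := by
  simp [cycFlip, h, sum_range_succ]

theorem cycFlip_of_cycLen_eq_three {w : Perm (Fin (2 * n))} {i : Fin n}
    (h : cycLen (pPerm 2 n twoPos w) i = 3) :
    cycFlip w i = flip w i + flip w (pPerm 2 n twoPos w i) +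
      flip w (pPerm 2 n twoPos w (pPerm 2 n twoPos w i)) := by
  simp [cycFlip, h, sum_range_succ]

/-- `w` has type the bipartition `(l₁, l₂)`. -/
def HasBitype (w : Perm (Fin (2 * n))) (l₁ l₂ : Multiset ℕ) : Prop :=
  tyFam 2 n twoPos w (onePartition 2) = l₁ ∧
    tyFam 2 n twoPos w (Nat.Partition.indiscrete 2) = l₂

theorem hasBitype_iff {w : Perm (Fin (2 * n))} (hw : IsBlockPerm 2 n w) {l₁ l₂ : Multiset ℕ} :
    HasBitype w l₁ l₂ ↔ (reps w 0).val.map (cycLen (pPerm 2 n twoPos w)) = l₁ ∧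
      (reps w 1).val.map (cycLen (pPerm 2 n twoPos w)) = l₂ := by
  rw [HasBitype, tyFam_two hw _ 0 (by simp [onePartition]), tyFam_two hw _ 1 (by simp)]

theorem apply_eq_self_of_count {w : Perm (Fin (2 * n))} {l : Multiset ℕ}
    (h : (reps w 0).val.map (cycLen (pPerm 2 n twoPos w)) = l) (S : Finset (Fin n))
    (hS : ∀ i ∈ S, pPerm 2 n twoPos w i = i → flip w i ≠ 0) (hc : l.count 1 + #S = n)
    (m : Fin n) (hm : m ∉ S) : pPerm 2 n twoPos w m = m ∧ flip w m = 0 := by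
  have h1 : #(univ.filter fun i => pPerm 2 n twoPos w i = i ∧ flip w i = 0) = l.count 1 := by
    rw [← h, Multiset.count_map, ← Finset.filter_val, ← Finset.card_def]
    congr 1
    ext i
    simp only [mem_filter, mem_univ, true_and, mem_reps, eq_comm (a := 1), cycLen_eq_one_iff]
    constructor
    · rintro ⟨hi, hf⟩
      exact ⟨⟨isLeast_of_fixed hi, by rwa [cycFlip_of_cycLen_eq_one (cycLen_eq_one_iff.mpr hi)]⟩, hi⟩
    · rintro ⟨⟨-, hf⟩, hi⟩
      exact ⟨hi, by rwa [cycFlip_of_cycLen_eq_one (cycLen_eq_one_iff.mpr hi)] at hf⟩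
  have h2 : (univ.filter fun i => pPerm 2 n twoPos w i = i ∧ flip w i = 0) = Sᶜ := by
    refine eq_of_subset_of_card_le (fun i hi => ?_) ?_
    · rw [mem_compl]
      intro hiS
      simp only [mem_filter, mem_univ, true_and] at hi
      exact hS i hiS hi.1 hi.2
    · rw [h1, card_compl, Fintype.card_fin]
      omega
  have h3 := mem_compl.mpr hm
  rw [← h2] at h3
  simpa using h3

/-- `w` exchanges the blocks `x` and `y`, with nontrivial cycle product. -/
def IsNegTransposition (w : Perm (Fin (2 * n))) (x y : Fin n) : Prop :=
  x ≠ y ∧ pPerm 2 n twoPos w x = y ∧ pPerm 2 n twoPos w y = x ∧ flip w x + flip w y = 1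

/-- `w` permutes the blocks `x`, `y` and `z` cyclically, with trivial cycle product. -/
def IsPosThreeCycle (w : Perm (Fin (2 * n))) (x y z : Fin n) : Prop :=
  x ≠ y ∧ y ≠ z ∧ z ≠ x ∧ pPerm 2 n twoPos w x = y ∧ pPerm 2 n twoPos w y = z ∧
    pPerm 2 n twoPos w z = x ∧ flip w x + flip w y + flip w z = 0

/-- `w` acts as the identity on the blocks outside `S`. -/
def TrivialOff (w : Perm (Fin (2 * n))) (S : Finset (Fin n)) : Prop :=
  ∀ m, m ∉ S → pPerm 2 n twoPos w m = m ∧ flip w m = 0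

theorem IsNegTransposition.symm {w : Perm (Fin (2 * n))} {x y : Fin n}
    (h : IsNegTransposition w x y) : IsNegTransposition w y x :=
  ⟨h.1.symm, h.2.2.1, h.2.1, by rw [add_comm, h.2.2.2]⟩

theorem isNegTransposition_of_mem_reps {w : Perm (Fin (2 * n))} {x : Fin n} (hx : x ∈ reps w 1)
    (h : cycLen (pPerm 2 n twoPos w) x = 2) :
    IsNegTransposition w x (pPerm 2 n twoPos w x) := by
  have hc := (mem_reps.mp hx).2
  rw [cycFlip_of_cycLen_eq_two h] at hc
  rw [cycLen_eq_two_iff] at h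
  exact ⟨h.1.symm, rfl, h.2, hc⟩

theorem isPosThreeCycle_of_mem_reps {w : Perm (Fin (2 * n))} {x : Fin n} (hx : x ∈ reps w 0)
    (h : cycLen (pPerm 2 n twoPos w) x = 3) :
    IsPosThreeCycle w x (pPerm 2 n twoPos w x)
      (pPerm 2 n twoPos w (pPerm 2 n twoPos w x)) := by
  have hc := (mem_reps.mp hx).2
  rw [cycFlip_of_cycLen_eq_three h] at hc
  rw [cycLen_eq_three_iff] at h
  refine ⟨h.1.symm, fun h' => h.1 ?_, fun h' => ?_, rfl, rfl, h.2, hc⟩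
  · exact ((pPerm 2 n twoPos w).injective h').symm
  · have := h.2
    rw [h'] at this
    exact h.1 this

theorem exists_of_map_reps_eq_pair {w : Perm (Fin (2 * n))} {c : Fin 2} {k : ℕ}
    (h : (reps w c).val.map (cycLen (pPerm 2 n twoPos w)) = {k, k}) :
    ∃ x y, x ≠ y ∧ x ∈ reps w c ∧ y ∈ reps w c ∧ cycLen (pPerm 2 n twoPos w) x = k ∧
      cycLen (pPerm 2 n twoPos w) y = k := by
  have hcard : #(reps w c) = 2 := by
    have := congrArg Multiset.card h
    simpa using this
  have hk (x) (hx : x ∈ reps w c) : cycLen (pPerm 2 n twoPos w) x = k := by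
    have := Multiset.mem_map_of_mem (cycLen (pPerm 2 n twoPos w)) (mem_val.mpr hx)
    rw [h] at this
    simpa using this
  obtain ⟨x, y, hxy, hr⟩ := card_eq_two.mp hcard
  have hx : x ∈ reps w c := by simp [hr]
  have hy : y ∈ reps w c := by simp [hr]
  exact ⟨x, y, hxy, hx, hy, hk x hx, hk y hy⟩

theorem exists_isNegTransposition_of_hasBitype {w : Perm (Fin (2 * n))} (hw : IsBlockPerm 2 n w)
    (hn : 2 ≤ n) (h : HasBitype w (Multiset.replicate (n - 2) 1) {2}) :
    ∃ x y, IsNegTransposition w x y ∧ TrivialOff w {x, y} := by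
  rw [hasBitype_iff hw] at h
  obtain ⟨x, hx, h2⟩ := Multiset.map_eq_singleton.mp h.2
  have hT := isNegTransposition_of_mem_reps (x := x) (by rw [← mem_val, hx]; simp) h2
  refine ⟨_, _, hT, apply_eq_self_of_count h.1 _ ?_ ?_⟩
  · obtain ⟨h1, -, h3, -⟩ := hT
    simp only [mem_insert, mem_singleton]
    rintro i (rfl | rfl) h'
    · exact absurd h'.symm h1
    · exact absurd (h3.symm.trans h') h1
  · rw [Multiset.count_replicate_self, card_pair hT.1]
    omega

theorem exists_isPosThreeCycle_of_hasBitype {w : Perm (Fin (2 * n))} (hw : IsBlockPerm 2 n w)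
    (hn : 3 ≤ n) (h : HasBitype w (Multiset.replicate (n - 3) 1 + {3}) 0) :
    ∃ x y z, IsPosThreeCycle w x y z ∧ TrivialOff w {x, y, z} := by
  rw [hasBitype_iff hw] at h
  obtain ⟨x, hx, h3⟩ : ∃ x ∈ (reps w 0).val, cycLen (pPerm 2 n twoPos w) x = 3 := by
    rw [← Multiset.mem_map, h.1]
    simp
  have hT := isPosThreeCycle_of_mem_reps hx h3
  refine ⟨_, _, _, hT, apply_eq_self_of_count h.1 _ ?_ ?_⟩
  · obtain ⟨h1, h2, h3, -, -, h4, -⟩ := hT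
    simp only [mem_insert, mem_singleton]
    rintro i (rfl | rfl | rfl) h'
    · exact absurd h'.symm h1
    · exact absurd h'.symm h2
    · exact absurd (h'.symm.trans h4) h3
  · obtain ⟨h1, h2, h3, -⟩ := hT
    rw [card_eq_three.mpr ⟨_, _, _, h1, h3.symm, h2, rfl⟩]
    simp
    omega

theorem exists_isNegTransposition_pair_of_hasBitype {w : Perm (Fin (2 * n))}
    (hw : IsBlockPerm 2 n w) (hn : 4 ≤ n)
    (h : HasBitype w (Multiset.replicate (n - 4) 1) {2, 2}) :
    ∃ x y z u, IsNegTransposition w x y ∧ IsNegTransposition w z u ∧ x ≠ z ∧ x ≠ u ∧ y ≠ z ∧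
      y ≠ u ∧ TrivialOff w {x, y, z, u} := by
  rw [hasBitype_iff hw] at h
  obtain ⟨x, z, hxz, hx, hz, hx2, hz2⟩ := exists_of_map_reps_eq_pair h.2
  have hTx := isNegTransposition_of_mem_reps hx hx2
  have hTz := isNegTransposition_of_mem_reps hz hz2
  have hyz : pPerm 2 n twoPos w x ≠ z := by
    intro h'
    have hs : (pPerm 2 n twoPos w).SameCycle x z := by
      rw [← h']
      exact Perm.sameCycle_apply_right.mpr (Perm.SameCycle.refl _ _)
    exact hxz (le_antisymm ((mem_reps.mp hx).1 _ hs) ((mem_reps.mp hz).1 _ hs.symm))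
  have hxu : x ≠ pPerm 2 n twoPos w z := by
    intro h'
    apply hyz
    rw [h', hTz.2.2.1]
  have hyu : pPerm 2 n twoPos w x ≠ pPerm 2 n twoPos w z :=
    fun h' => hxz ((pPerm 2 n twoPos w).injective h')
  refine ⟨_, _, _, _, hTx, hTz, hxz, hxu, hyz, hyu, apply_eq_self_of_count h.1 _ ?_ ?_⟩
  · obtain ⟨h1, -, h3, -⟩ := hTx
    obtain ⟨h4, -, h5, -⟩ := hTz
    simp only [mem_insert, mem_singleton]
    rintro i (rfl | rfl | rfl | rfl) h'
    · exact absurd h'.symm h1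
    · exact absurd (h3.symm.trans h') h1
    · exact absurd h'.symm h4
    · exact absurd (h5.symm.trans h') h4
  · rw [Multiset.count_replicate_self, card_insert_of_notMem, card_insert_of_notMem,
      card_pair hTz.1]
    · omega
    all_goals simp [hTx.1, hxz, hxu, hyz, hyu]

theorem exists_flip_of_hasBitype {w : Perm (Fin (2 * n))} (hw : IsBlockPerm 2 n w) (hn : 2 ≤ n)
    (h : HasBitype w (Multiset.replicate (n - 2) 1) {1, 1}) :
    ∃ x y, x ≠ y ∧ (∀ i, pPerm 2 n twoPos w i = i) ∧ flip w x = 1 ∧ flip w y = 1 ∧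
      TrivialOff w {x, y} := by
  rw [hasBitype_iff hw] at h
  obtain ⟨x, y, hxy, hx, hy, hx1, hy1⟩ := exists_of_map_reps_eq_pair h.2
  have hfx := (mem_reps.mp hx).2
  have hfy := (mem_reps.mp hy).2
  rw [cycFlip_of_cycLen_eq_one hx1] at hfx
  rw [cycFlip_of_cycLen_eq_one hy1] at hfy
  rw [cycLen_eq_one_iff] at hx1 hy1
  have hoff : TrivialOff w {x, y} := apply_eq_self_of_count h.1 _ (by simp [hfx, hfy]) (by
    rw [Multiset.count_replicate_self, card_pair hxy]
    omega)
  refine ⟨x, y, hxy, fun i => ?_, hfx, hfy, hoff⟩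
  by_cases hi : i ∈ ({x, y} : Finset (Fin n))
  · simp only [mem_insert, mem_singleton] at hi
    rcases hi with rfl | rfl <;> assumption
  · exact (hoff i hi).1

theorem eq_one_of_trivialOff_empty {w : Perm (Fin (2 * n))} (hw : IsBlockPerm 2 n w)
    (h : TrivialOff w ∅) : w = 1 := by
  have h1 (i : Fin n) := pPerm_flip_of_apply (isBlockPerm_one 2 n) (i := i) (c := 0) rfl
  refine blockPerm_ext hw (isBlockPerm_one 2 n) (fun i => ?_) fun i => ?_
  · rw [(h i (notMem_empty i)).1, (h1 i).1]
  · rw [(h i (notMem_empty i)).2, (h1 i).2]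

theorem eq_one_of_hasBitype {w : Perm (Fin (2 * n))} (hw : IsBlockPerm 2 n w)
    (h : HasBitype w (Multiset.replicate n 1) 0) : w = 1 := by
  rw [hasBitype_iff hw] at h
  exact eq_one_of_trivialOff_empty hw (apply_eq_self_of_count h.1 ∅ (by simp) (by simp))

theorem hasBitype_of_reps {w : Perm (Fin (2 * n))} (hw : IsBlockPerm 2 n w)
    {l₁ l₂ : Multiset ℕ} (R₀ R₁ : Finset (Fin n))
    (h₀ : ∀ i, i ∈ R₀ ↔ IsLeast (pPerm 2 n twoPos w) i ∧ cycFlip w i = 0)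
    (h₁ : ∀ i, i ∈ R₁ ↔ IsLeast (pPerm 2 n twoPos w) i ∧ cycFlip w i = 1)
    (hl₁ : R₀.val.map (cycLen (pPerm 2 n twoPos w)) = l₁)
    (hl₂ : R₁.val.map (cycLen (pPerm 2 n twoPos w)) = l₂) : HasBitype w l₁ l₂ := by
  have e₀ : reps w 0 = R₀ := by ext i; rw [mem_reps, h₀]
  have e₁ : reps w 1 = R₁ := by ext i; rw [mem_reps, h₁]
  rw [hasBitype_iff hw, e₀, e₁]
  exact ⟨hl₁, hl₂⟩

theorem map_cycLen_compl {w : Perm (Fin (2 * n))} {S : Finset (Fin n)} (hS : TrivialOff w S)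
    {k : ℕ} (hk : #S = k) :
    Sᶜ.val.map (cycLen (pPerm 2 n twoPos w)) = Multiset.replicate (n - k) 1 := by
  rw [Multiset.map_congr rfl (fun i hi => cycLen_eq_one_iff.mpr
    (hS i (mem_compl.mp (mem_val.mp hi))).1), Multiset.map_const']
  congr 1
  rw [← card_def, card_compl, Fintype.card_fin, hk]

theorem TrivialOff.isLeast {w : Perm (Fin (2 * n))} {S : Finset (Fin n)} (hS : TrivialOff w S)
    {i : Fin n} (hi : i ∉ S) : IsLeast (pPerm 2 n twoPos w) i :=
  isLeast_of_fixed (hS i hi).1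

theorem TrivialOff.cycFlip {w : Perm (Fin (2 * n))} {S : Finset (Fin n)} (hS : TrivialOff w S)
    {i : Fin n} (hi : i ∉ S) : cycFlip w i = 0 := by
  rw [cycFlip_of_cycLen_eq_one (cycLen_eq_one_iff.mpr (hS i hi).1), (hS i hi).2]

theorem IsNegTransposition.cycLen {w : Perm (Fin (2 * n))} {x y : Fin n}
    (h : IsNegTransposition w x y) : cycLen (pPerm 2 n twoPos w) x = 2 := by
  obtain ⟨h1, h2, h3, -⟩ := h
  rw [cycLen_eq_two_iff, h2, h3]
  exact ⟨h1.symm, rfl⟩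

theorem IsNegTransposition.cycFlip {w : Perm (Fin (2 * n))} {x y : Fin n}
    (h : IsNegTransposition w x y) : cycFlip w x = 1 := by
  rw [cycFlip_of_cycLen_eq_two h.cycLen, h.2.1, h.2.2.2]

theorem IsNegTransposition.isLeast {w : Perm (Fin (2 * n))} {x y : Fin n}
    (h : IsNegTransposition w x y) (hxy : x < y) : IsLeast (pPerm 2 n twoPos w) x := by
  intro j hj
  have := sameCycle_induction (P := fun j => j = x ∨ j = y) (by
    rintro i (rfl | rfl)
    · exact Or.inr h.2.1
    · exact Or.inl h.2.2.1) (Or.inl rfl) hj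
  rcases this with rfl | rfl
  · exact le_rfl
  · exact hxy.le

theorem IsNegTransposition.not_isLeast {w : Perm (Fin (2 * n))} {x y : Fin n}
    (h : IsNegTransposition w x y) (hxy : x < y) : ¬ IsLeast (pPerm 2 n twoPos w) y :=
  not_isLeast_of_lt (by rwa [h.2.2.1])

theorem hasBitype_of_isNegTransposition {w : Perm (Fin (2 * n))} (hw : IsBlockPerm 2 n w)
    {x y : Fin n} (h : IsNegTransposition w x y) (hoff : TrivialOff w {x, y}) :
    HasBitype w (Multiset.replicate (n - 2) 1) {2} := by
  wlog hxy : x < y generalizing x y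
  · exact this h.symm (by rwa [pair_comm]) (lt_of_le_of_ne (not_lt.mp hxy) h.1.symm)
  refine hasBitype_of_reps hw {x, y}ᶜ {x} (fun i => ?_) (fun i => ?_)
    (map_cycLen_compl hoff (card_pair h.1)) (by simp [h.cycLen])
  all_goals
    by_cases hi : i ∈ ({x, y} : Finset (Fin n))
    · simp only [mem_insert, mem_singleton] at hi
      rcases hi with rfl | rfl <;>
        simp [h.cycFlip, h.isLeast hxy, h.not_isLeast hxy, hxy.ne']
    · have h1 := hoff.isLeast hi
      have h2 := hoff.cycFlip hi
      simp only [mem_insert, mem_singleton] at hi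
      simp [h1, h2]
      tauto

theorem hasBitype_of_isNegTransposition_pair {w : Perm (Fin (2 * n))} (hw : IsBlockPerm 2 n w)
    {x y z u : Fin n} (h : IsNegTransposition w x y) (h' : IsNegTransposition w z u)
    (hxz : x ≠ z) (hxu : x ≠ u) (hyz : y ≠ z) (hyu : y ≠ u)
    (hoff : TrivialOff w {x, y, z, u}) :
    HasBitype w (Multiset.replicate (n - 4) 1) {2, 2} := by
  wlog hxy : x < y generalizing x y
  · exact this h.symm hyz hyu hxz hxu (by rwa [insert_comm])
      (lt_of_le_of_ne (not_lt.mp hxy) h.1.symm)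
  wlog hzu : z < u generalizing z u
  · exact this h'.symm hxu hxz hyu hyz (by rwa [pair_comm])
      (lt_of_le_of_ne (not_lt.mp hzu) h'.1.symm)
  have hcard : #({x, y, z, u} : Finset (Fin n)) = 4 := by
    rw [card_insert_of_notMem, card_insert_of_notMem, card_pair h'.1] <;>
      simp [h.1, hxz, hxu, hyz, hyu]
  refine hasBitype_of_reps hw {x, y, z, u}ᶜ {x, z} (fun i => ?_) (fun i => ?_)
    (map_cycLen_compl hoff hcard)
    (by rw [insert_val_of_notMem (by simpa using hxz)]; simp [h.cycLen, h'.cycLen])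
  all_goals
    by_cases hi : i ∈ ({x, y, z, u} : Finset (Fin n))
    · simp only [mem_insert, mem_singleton] at hi
      rcases hi with rfl | rfl | rfl | rfl <;>
        simp [h.cycFlip, h.isLeast hxy, h.not_isLeast hxy, hxy.ne', h'.cycFlip, h'.isLeast hzu,
          h'.not_isLeast hzu, hzu.ne', hxz, hxu, hyz, hyu, hxz.symm, hxu.symm]
    · have h1 := hoff.isLeast hi
      have h2 := hoff.cycFlip hi
      simp only [mem_insert, mem_singleton] at hi
      simp [h1, h2]
      tauto

theorem IsPosThreeCycle.rotate {w : Perm (Fin (2 * n))} {x y z : Fin n}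
    (h : IsPosThreeCycle w x y z) : IsPosThreeCycle w y z x := by
  obtain ⟨h1, h2, h3, h4, h5, h6, h7⟩ := h
  exact ⟨h2, h3, h1, h5, h6, h4, by rw [← h7, add_comm, ← add_assoc]⟩

theorem IsPosThreeCycle.cycLen {w : Perm (Fin (2 * n))} {x y z : Fin n}
    (h : IsPosThreeCycle w x y z) : cycLen (pPerm 2 n twoPos w) x = 3 := by
  obtain ⟨h1, h2, h3, h4, h5, h6, h7⟩ := h
  rw [cycLen_eq_three_iff, h4, h5, h6]
  exact ⟨h1.symm, rfl⟩

theorem IsPosThreeCycle.cycFlip {w : Perm (Fin (2 * n))} {x y z : Fin n}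
    (h : IsPosThreeCycle w x y z) : cycFlip w x = 0 := by
  rw [cycFlip_of_cycLen_eq_three h.cycLen]
  obtain ⟨h1, h2, h3, h4, h5, h6, h7⟩ := h
  rw [h4, h5, h7]

theorem IsPosThreeCycle.isLeast_iff {w : Perm (Fin (2 * n))} {x y z : Fin n}
    (h : IsPosThreeCycle w x y z) : IsLeast (pPerm 2 n twoPos w) x ↔ x < y ∧ x < z := by
  obtain ⟨h1, h2, h3, h4, h5, h6, -⟩ := h
  constructor
  · intro hx
    have hy : (pPerm 2 n twoPos w).SameCycle x y := by
      rw [← h4]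
      exact Perm.sameCycle_apply_right.mpr (Perm.SameCycle.refl _ _)
    have hz : (pPerm 2 n twoPos w).SameCycle x z := by
      rw [← h5]
      exact Perm.sameCycle_apply_right.mpr hy
    exact ⟨lt_of_le_of_ne (hx _ hy) h1, lt_of_le_of_ne (hx _ hz) h3.symm⟩
  · intro hx j hj
    have := sameCycle_induction (P := fun j => j = x ∨ j = y ∨ j = z) (by
      rintro i (rfl | rfl | rfl) <;> simp [*]) (Or.inl rfl) hj
    rcases this with rfl | rfl | rfl
    · exact le_rfl
    · exact hx.1.le
    · exact hx.2.le

theorem hasBitype_of_isPosThreeCycle {w : Perm (Fin (2 * n))} (hw : IsBlockPerm 2 n w)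
    {x y z : Fin n} (h : IsPosThreeCycle w x y z) (hoff : TrivialOff w {x, y, z}) :
    HasBitype w (Multiset.replicate (n - 3) 1 + {3}) 0 := by
  wlog hx : x < y ∧ x < z generalizing x y z
  · have key : (y < z ∧ y < x) ∨ (z < x ∧ z < y) := by
      have := h.1
      have := h.2.1
      have := h.2.2.1
      omega
    have hr : ({y, z, x} : Finset (Fin n)) = {x, y, z} := by ext; simp; tauto
    have hr' : ({z, x, y} : Finset (Fin n)) = {x, y, z} := by ext; simp; tauto
    rcases key with h' | h'
    · exact this h.rotate (by rwa [hr]) h'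
    · exact this h.rotate.rotate (by rwa [hr']) h'
  have hcard : #({x, y, z} : Finset (Fin n)) = 3 :=
    card_eq_three.mpr ⟨x, y, z, h.1, h.2.2.1.symm, h.2.1, rfl⟩
  have hlx : IsLeast (pPerm 2 n twoPos w) x := h.isLeast_iff.mpr hx
  have hly : ¬ IsLeast (pPerm 2 n twoPos w) y := by
    rw [h.rotate.isLeast_iff]
    omega
  have hlz : ¬ IsLeast (pPerm 2 n twoPos w) z := by
    rw [h.rotate.rotate.isLeast_iff]
    omega
  refine hasBitype_of_reps hw (insert x {x, y, z}ᶜ) ∅ (fun i => ?_) (fun i => ?_) ?_ (by simp)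
  · by_cases hi : i ∈ ({x, y, z} : Finset (Fin n))
    · simp only [mem_insert, mem_singleton] at hi
      rcases hi with rfl | rfl | rfl
      · simp [hlx, h.cycFlip]
      · simp [hly, h.1.symm]
      · simp [hlz, h.2.2.1]
    · simp [hoff.isLeast hi, hoff.cycFlip hi]
      simp at hi
      tauto
  · by_cases hi : i ∈ ({x, y, z} : Finset (Fin n))
    · simp only [mem_insert, mem_singleton] at hi
      rcases hi with rfl | rfl | rfl <;> simp [hly, hlz, h.cycFlip]
    · simp [hoff.cycFlip hi]
  · rw [insert_val_of_notMem (by simp), Multiset.map_cons, map_cycLen_compl hoff hcard, h.cycLen,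
      Multiset.add_comm, Multiset.singleton_add]

theorem hasBitype_of_flip {w : Perm (Fin (2 * n))} (hw : IsBlockPerm 2 n w)
    {x y : Fin n} (hxy : x ≠ y) (hp : ∀ i, pPerm 2 n twoPos w i = i) (hx : flip w x = 1)
    (hy : flip w y = 1) (hoff : TrivialOff w {x, y}) :
    HasBitype w (Multiset.replicate (n - 2) 1) {1, 1} := by
  have hl (i) : cycLen (pPerm 2 n twoPos w) i = 1 := cycLen_eq_one_iff.mpr (hp i)
  have hf (i) : cycFlip w i = flip w i := cycFlip_of_cycLen_eq_one (hl i)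
  refine hasBitype_of_reps hw {x, y}ᶜ {x, y} (fun i => ?_) (fun i => ?_)
    (map_cycLen_compl hoff (card_pair hxy))
    (by rw [insert_val_of_notMem (by simpa using hxy)]; simp [hl])
  all_goals
    by_cases hi : i ∈ ({x, y} : Finset (Fin n))
    · have h1 := isLeast_of_fixed (hp i)
      simp only [mem_insert, mem_singleton] at hi
      rcases hi with rfl | rfl <;> simp [hf, hx, hy, h1]
    · have h1 := isLeast_of_fixed (hp i)
      have h2 := (hoff i hi).2
      simp only [mem_insert, mem_singleton] at hi
      simp [hf, h1, h2]
      tauto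

theorem hasBitype_one : HasBitype (1 : Perm (Fin (2 * n))) (Multiset.replicate n 1) 0 := by
  have h1 (i : Fin n) := pPerm_flip_of_apply (isBlockPerm_one 2 n) (i := i) (c := 0) rfl
  have hoff : TrivialOff (1 : Perm (Fin (2 * n))) ∅ := fun i _ => h1 i
  refine hasBitype_of_reps (isBlockPerm_one 2 n) ∅ᶜ ∅ (fun i => ?_) (fun i => ?_)
    (map_cycLen_compl hoff card_empty) (by simp)
  all_goals simp [hoff.isLeast, hoff.cycFlip]

theorem pPerm_negSwap (i j m : Fin n) :
    pPerm 2 n twoPos (negSwap i j : Bgrp 2 n).1 m = if m = i then j else if m = j then i else m := by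
  rw [← swap_apply_def]
  exact (pPerm_flip_ofSigns _ _ m).1

theorem flip_negSwap (i j m : Fin n) :
    flip (negSwap i j : Bgrp 2 n).1 m = if m = j then 1 else 0 := by
  rw [← Pi.single_apply]
  exact (pPerm_flip_ofSigns _ _ m).2

theorem pPerm_negSwap_mul (i j m : Fin n) (w : Bgrp 2 n) :
    pPerm 2 n twoPos (negSwap i j * w).1 m =
      if pPerm 2 n twoPos w.1 m = i then j else
        if pPerm 2 n twoPos w.1 m = j then i else pPerm 2 n twoPos w.1 m := by
  rw [← pPerm_negSwap]
  exact (pPerm_flip_mul (negSwap i j).2 w.2 m).1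

theorem flip_negSwap_mul (i j m : Fin n) (w : Bgrp 2 n) :
    flip (negSwap i j * w).1 m =
      flip w.1 m + if pPerm 2 n twoPos w.1 m = j then 1 else 0 := by
  rw [← flip_negSwap i j]
  exact (pPerm_flip_mul (negSwap i j).2 w.2 m).2

theorem negSwap_mul_negSwap_swap {i j : Fin n} (hij : i ≠ j) :
    (negSwap i j * negSwap j i : Bgrp 2 n) = 1 := by
  refine Subtype.ext (eq_one_of_trivialOff_empty (negSwap i j * negSwap j i).2 fun m _ => ?_)
  rw [pPerm_negSwap_mul, flip_negSwap_mul, pPerm_negSwap, flip_negSwap]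
  grind -ring -linarith [zero_add, add_zero]

theorem inv_negSwap {i j : Fin n} (hij : i ≠ j) : (negSwap i j : Bgrp 2 n)⁻¹ = negSwap j i :=
  inv_eq_of_mul_eq_one_right (negSwap_mul_negSwap_swap hij)

theorem Fin.two_add_eq_one {a b : Fin 2} (h : a + b = 1) : a = 0 ∧ b = 1 ∨ a = 1 ∧ b = 0 := by
  revert a b
  decide

theorem hasBitype_iff_exists_negSwap (hn : 2 ≤ n) (w : Bgrp 2 n) :
    HasBitype w.1 (Multiset.replicate (n - 2) 1) {2} ↔ ∃ i j, i ≠ j ∧ w = negSwap i j := by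
  constructor
  · intro h
    obtain ⟨x, y, hT, hoff⟩ := exists_isNegTransposition_of_hasBitype w.2 hn h
    wlog hx : flip w.1 x = 0 ∧ flip w.1 y = 1 generalizing x y
    · have hs := Fin.two_add_eq_one hT.2.2.2
      exact this y x hT.symm (by rwa [pair_comm]) (by tauto)
    obtain ⟨hxy, h1, h2, -⟩ := hT
    refine ⟨x, y, hxy, Subtype.ext (blockPerm_ext w.2 (negSwap x y).2 (fun m => ?_) fun m => ?_)⟩
    all_goals
      have := hoff m
      simp only [pPerm_negSwap, flip_negSwap, mem_insert, mem_singleton] at *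
      grind -ring -linarith [zero_add, add_zero]
  · rintro ⟨i, j, hij, rfl⟩
    refine hasBitype_of_isNegTransposition (negSwap i j).2 (x := i) (y := j) ?_ fun m hm => ?_
    · simp only [IsNegTransposition, pPerm_negSwap, flip_negSwap]
      grind -ring -linarith [zero_add, add_zero]
    · simp only [pPerm_negSwap, flip_negSwap, mem_insert, mem_singleton] at *
      grind -ring -linarith [zero_add, add_zero]

theorem hasBitype_negSwap_mul_negSwap {i j k l : Fin n} (hij : i ≠ j) (hkl : k ≠ l) :
    HasBitype (negSwap i j * negSwap k l : Bgrp 2 n).1 (Multiset.replicate n 1) 0 ∨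
    HasBitype (negSwap i j * negSwap k l : Bgrp 2 n).1 (Multiset.replicate (n - 2) 1) {1, 1} ∨
    HasBitype (negSwap i j * negSwap k l : Bgrp 2 n).1 (Multiset.replicate (n - 4) 1) {2, 2} ∨
    HasBitype (negSwap i j * negSwap k l : Bgrp 2 n).1
      (Multiset.replicate (n - 3) 1 + {3}) 0 := by
  have hp := fun m => pPerm_negSwap_mul i j m (negSwap k l)
  have hf := fun m => flip_negSwap_mul i j m (negSwap k l)
  simp only [pPerm_negSwap, flip_negSwap] at hp hf
  have three (x y z : Fin n) (hT : IsPosThreeCycle (negSwap i j * negSwap k l : Bgrp 2 n).1 x y z)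
      (hoff : TrivialOff (negSwap i j * negSwap k l : Bgrp 2 n).1 {x, y, z}) :=
    hasBitype_of_isPosThreeCycle (negSwap i j * negSwap k l).2 hT hoff
  have h11 : (1 : Fin 2) + 1 = 0 := rfl
  by_cases h1 : k = j ∧ l = i
  · left
    rw [h1.1, h1.2, negSwap_mul_negSwap_swap hij]
    exact hasBitype_one
  by_cases h2 : k = i ∧ l = j
  · right; left
    refine hasBitype_of_flip (negSwap i j * negSwap k l).2 hij (fun m => ?_) ?_ ?_ fun m hm => ?_
    all_goals simp only [hp, hf, mem_insert, mem_singleton] at *; grind -ring -linarith [zero_add, add_zero]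
  by_cases h3 : k ≠ i ∧ k ≠ j ∧ l ≠ i ∧ l ≠ j
  · right; right; left
    refine hasBitype_of_isNegTransposition_pair (negSwap i j * negSwap k l).2 (x := i) (y := j)
      (z := k) (u := l) ?_ ?_ ?_ ?_ ?_ ?_ fun m hm => ?_
    all_goals simp only [IsNegTransposition, hp, hf, mem_insert, mem_singleton] at *; grind -ring -linarith [zero_add, add_zero]
  right; right; right
  simp only [TrivialOff, IsPosThreeCycle, hp, hf, mem_insert, mem_singleton] at three
  by_cases h4 : k = j
  · apply three i j l <;> grind -ring -linarith [zero_add, add_zero]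
  by_cases h5 : l = j
  · apply three i j k <;> grind -ring -linarith [zero_add, add_zero]
  by_cases h6 : k = i
  · apply three i l j <;> grind -ring -linarith [zero_add, add_zero]
  · apply three i k j <;> grind -ring -linarith [zero_add, add_zero]

open scoped Classical in
/-- The elements of type `((1^{n-2}), (2))`. -/
noncomputable def negSwaps (n : ℕ) : Finset (Bgrp 2 n) :=
  univ.filter fun w => HasBitype w.1 (Multiset.replicate (n - 2) 1) {2}

theorem mem_negSwaps (hn : 2 ≤ n) {w : Bgrp 2 n} :
    w ∈ negSwaps n ↔ ∃ i j, i ≠ j ∧ w = negSwap i j := by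
  rw [← hasBitype_iff_exists_negSwap hn]
  simp [negSwaps]

open scoped Classical in
/-- The left factors of the factorizations of `w` into two elements of `negSwaps n`. -/
noncomputable def leftFactors (w : Bgrp 2 n) : Finset (Bgrp 2 n) :=
  (negSwaps n).filter fun a => a⁻¹ * w ∈ negSwaps n

theorem mem_leftFactors (hn : 2 ≤ n) {w a : Bgrp 2 n} : a ∈ leftFactors w ↔
    ∃ i j k l, i ≠ j ∧ k ≠ l ∧ a = negSwap i j ∧ w = negSwap i j * negSwap k l := by
  simp only [leftFactors, mem_filter, mem_negSwaps hn]
  constructor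
  · rintro ⟨⟨i, j, hij, rfl⟩, k, l, hkl, h⟩
    exact ⟨i, j, k, l, hij, hkl, rfl, by rw [← h, mul_inv_cancel_left]⟩
  · rintro ⟨i, j, k, l, hij, hkl, rfl, rfl⟩
    exact ⟨⟨i, j, hij, rfl⟩, k, l, hkl, by rw [inv_mul_cancel_left]⟩

theorem negSwap_mem_leftFactors (hn : 2 ≤ n) {w : Bgrp 2 n} {i j : Fin n} (hij : i ≠ j)
    {x y : Fin n} (hT : IsNegTransposition (negSwap j i * w).1 x y)
    (hoff : TrivialOff (negSwap j i * w).1 {x, y}) : negSwap i j ∈ leftFactors w := by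
  rw [leftFactors, mem_filter, mem_negSwaps hn, inv_negSwap hij]
  refine ⟨⟨i, j, hij, rfl⟩, ?_⟩
  simp only [negSwaps, mem_filter, mem_univ, true_and]
  exact hasBitype_of_isNegTransposition (negSwap j i * w).2 hT hoff

theorem negSwap_inj {i j k l : Fin n} (hij : i ≠ j)
    (h : (negSwap i j : Bgrp 2 n) = negSwap k l) : i = k ∧ j = l := by
  have h1 := pPerm_negSwap k l i
  have h2 := flip_negSwap k l j
  rw [← h, pPerm_negSwap] at h1
  rw [← h, flip_negSwap] at h2
  grind -ring -linarith [zero_add, add_zero]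

/-- The transposition-like left factor of `w` whose support contains the block `m`. -/
noncomputable def factorAt (w : Bgrp 2 n) (m : Fin n) : Bgrp 2 n :=
  if flip w.1 m = 0 then negSwap m (pPerm 2 n twoPos w.1 m) else negSwap (pPerm 2 n twoPos w.1 m) m

theorem exists_eq_factorAt {i j k l : Fin n} (hij : i ≠ j) (hkl : k ≠ l)
    {w : Bgrp 2 n} (hw : w = negSwap i j * negSwap k l) {x : Fin n}
    (hx : pPerm 2 n twoPos w.1 x ≠ x) :
    ∃ m, pPerm 2 n twoPos w.1 m ≠ m ∧ negSwap i j = factorAt w m := by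
  have hp := fun m => pPerm_negSwap_mul i j m (negSwap k l)
  have hf := fun m => flip_negSwap_mul i j m (negSwap k l)
  simp only [pPerm_negSwap, flip_negSwap, ← hw] at hp hf
  have key : (pPerm 2 n twoPos w.1 i = j ∧ flip w.1 i = 0) ∨
      (pPerm 2 n twoPos w.1 j = i ∧ flip w.1 j ≠ 0) := by
    simp only [hp, hf] at *
    grind -ring -linarith [zero_add, add_zero]
  rcases key with h | h
  · exact ⟨i, by rw [h.1]; exact hij.symm, by rw [factorAt, if_pos h.2, h.1]⟩
  · exact ⟨j, by rw [h.1]; exact hij, by rw [factorAt, if_neg h.2, h.1]⟩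

theorem exists_factorAt_of_mem_leftFactors (hn : 2 ≤ n) {w a : Bgrp 2 n} (ha : a ∈ leftFactors w)
    {x : Fin n} (hx : pPerm 2 n twoPos w.1 x ≠ x) :
    ∃ m, pPerm 2 n twoPos w.1 m ≠ m ∧ a = factorAt w m := by
  obtain ⟨i, j, k, l, hij, hkl, rfl, hw⟩ := (mem_leftFactors hn).mp ha
  exact exists_eq_factorAt hij hkl hw hx

theorem factorAt_mem_of_isPosThreeCycle (hn : 2 ≤ n) {w : Bgrp 2 n} {x y z : Fin n}
    (h : IsPosThreeCycle w.1 x y z) (hoff : TrivialOff w.1 {x, y, z}) :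
    factorAt w x ∈ leftFactors w := by
  obtain ⟨h1, h2, h3, h4, h5, h6, h7⟩ := h
  have hs : ∀ a : Fin 2, a ≠ 0 → a = 1 := by decide
  have ha : ∀ a b c : Fin 2, a + b + c = 0 → a = 0 → b + (c + 1) = 1 := by decide
  have hb : ∀ a b c : Fin 2, a + b + c = 0 → a = 1 → b + c = 1 := by decide
  have hx := hs (flip w.1 x)
  have hA := ha _ _ _ h7
  have hB := hb _ _ _ h7
  simp only [TrivialOff, mem_insert, mem_singleton] at hoff
  rw [factorAt, h4]
  split_ifs with h0
  all_goals
    refine negSwap_mem_leftFactors hn (by tauto) (x := y) (y := z) ?_ fun m hm => ?_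
    · simp only [IsNegTransposition, pPerm_negSwap_mul, flip_negSwap_mul, h5, h6]
      grind -ring -linarith [zero_add, add_zero]
    · have := hoff m
      simp only [pPerm_negSwap_mul, flip_negSwap_mul, mem_insert, mem_singleton] at *
      grind -ring -linarith [zero_add, add_zero]

theorem factorAt_ne_of_isPosThreeCycle {w : Bgrp 2 n} {x y z : Fin n}
    (h : IsPosThreeCycle w.1 x y z) : factorAt w x ≠ factorAt w y := by
  obtain ⟨h1, h2, h3, h4, h5, h6, h7⟩ := h
  rw [factorAt, factorAt, h4, h5]
  split_ifs
  all_goals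
    intro h
    have := negSwap_inj (by tauto) h
    grind -ring -linarith [zero_add, add_zero]

theorem card_leftFactors_of_isPosThreeCycle (hn : 2 ≤ n) {w : Bgrp 2 n} {x y z : Fin n}
    (h : IsPosThreeCycle w.1 x y z) (hoff : TrivialOff w.1 {x, y, z}) : #(leftFactors w) = 3 := by
  classical
  have hr : ({y, z, x} : Finset (Fin n)) = {x, y, z} := by ext; simp; tauto
  have hr' : ({z, x, y} : Finset (Fin n)) = {x, y, z} := by ext; simp; tauto
  refine card_eq_three.mpr ⟨factorAt w x, factorAt w y, factorAt w z,
    factorAt_ne_of_isPosThreeCycle h, (factorAt_ne_of_isPosThreeCycle h.rotate.rotate).symm,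
    factorAt_ne_of_isPosThreeCycle h.rotate, ?_⟩
  ext a
  simp only [mem_insert, mem_singleton]
  constructor
  · intro ha
    obtain ⟨m, hm, rfl⟩ := exists_factorAt_of_mem_leftFactors hn ha (x := x)
      (by rw [h.2.2.2.1]; exact h.1.symm)
    have : m ∈ ({x, y, z} : Finset (Fin n)) := by
      by_contra hm'
      exact hm (hoff m hm').1
    simp only [mem_insert, mem_singleton] at this
    rcases this with rfl | rfl | rfl <;> simp
  · rintro (rfl | rfl | rfl)
    · exact factorAt_mem_of_isPosThreeCycle hn h hoff
    · exact factorAt_mem_of_isPosThreeCycle hn h.rotate (by rwa [hr])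
    · exact factorAt_mem_of_isPosThreeCycle hn h.rotate.rotate (by rwa [hr'])

theorem IsNegTransposition.factorAt_eq {w : Bgrp 2 n} {x y : Fin n}
    (h : IsNegTransposition w.1 x y) : factorAt w x = factorAt w y := by
  obtain ⟨h1, h2, h3, h4⟩ := h
  rw [factorAt, factorAt, h2, h3]
  rcases Fin.two_add_eq_one h4 with h | h <;> simp [h.1, h.2]

theorem factorAt_mem_of_isNegTransposition_pair (hn : 2 ≤ n) {w : Bgrp 2 n} {x y z u : Fin n}
    (h : IsNegTransposition w.1 x y) (h' : IsNegTransposition w.1 z u) (hxz : x ≠ z) (hxu : x ≠ u)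
    (hyz : y ≠ z) (hyu : y ≠ u) (hoff : TrivialOff w.1 {x, y, z, u}) :
    factorAt w x ∈ leftFactors w := by
  wlog hx : flip w.1 x = 0 generalizing x y
  · rw [h.factorAt_eq]
    refine this h.symm hyz hyu hxz hxu (by rwa [insert_comm]) ?_
    have hs := Fin.two_add_eq_one h.2.2.2
    tauto
  obtain ⟨h1, h2, h3, h4⟩ := h
  obtain ⟨h5, h6, h7, h8⟩ := h'
  have hy : flip w.1 y = 1 := by simpa [hx] using h4
  have h11 : (1 : Fin 2) + 1 = 0 := rfl
  simp only [TrivialOff, mem_insert, mem_singleton] at hoff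
  rw [factorAt, h2, if_pos hx]
  refine negSwap_mem_leftFactors hn h1 (x := z) (y := u) ?_ fun m hm => ?_
  · simp only [IsNegTransposition, pPerm_negSwap_mul, flip_negSwap_mul, h6, h7]
    grind -ring -linarith [zero_add, add_zero]
  · have := hoff m
    simp only [pPerm_negSwap_mul, flip_negSwap_mul, mem_insert, mem_singleton] at *
    grind -ring -linarith [zero_add, add_zero]

theorem card_leftFactors_of_isNegTransposition_pair (hn : 2 ≤ n) {w : Bgrp 2 n} {x y z u : Fin n}
    (h : IsNegTransposition w.1 x y) (h' : IsNegTransposition w.1 z u) (hxz : x ≠ z) (hxu : x ≠ u)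
    (hyz : y ≠ z) (hyu : y ≠ u) (hoff : TrivialOff w.1 {x, y, z, u}) : #(leftFactors w) = 2 := by
  classical
  have hr : ({z, u, x, y} : Finset (Fin n)) = {x, y, z, u} := by ext; simp; tauto
  refine card_eq_two.mpr ⟨factorAt w x, factorAt w z, ?_, ?_⟩
  · rw [factorAt, factorAt, h.2.1, h'.2.1]
    have := h.1
    split_ifs
    all_goals
      intro h
      have := negSwap_inj (by tauto) h
      grind -ring -linarith [zero_add, add_zero]
  ext a
  simp only [mem_insert, mem_singleton]
  constructor
  · intro ha
    obtain ⟨m, hm, rfl⟩ := exists_factorAt_of_mem_leftFactors hn ha (x := x)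
      (by rw [h.2.1]; exact h.1.symm)
    have : m ∈ ({x, y, z, u} : Finset (Fin n)) := by
      by_contra hm'
      exact hm (hoff m hm').1
    simp only [mem_insert, mem_singleton] at this
    rcases this with rfl | rfl | rfl | rfl
    · simp
    · simp [h.factorAt_eq]
    · simp
    · simp [h'.factorAt_eq]
  · rintro (rfl | rfl)
    · exact factorAt_mem_of_isNegTransposition_pair hn h h' hxz hxu hyz hyu hoff
    · exact factorAt_mem_of_isNegTransposition_pair hn h' h hxz.symm hyz.symm hxu.symm hyu.symm
        (by rwa [hr])

theorem negSwap_mem_leftFactors_of_flip (hn : 2 ≤ n) {w : Bgrp 2 n} {x y : Fin n} (hxy : x ≠ y)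
    (hp : ∀ i, pPerm 2 n twoPos w.1 i = i) (hx : flip w.1 x = 1) (hy : flip w.1 y = 1)
    (hoff : TrivialOff w.1 {x, y}) : negSwap x y ∈ leftFactors w := by
  have h11 : (1 : Fin 2) + 1 = 0 := rfl
  refine negSwap_mem_leftFactors hn hxy (x := x) (y := y) ?_ fun m hm => ?_
  · simp only [IsNegTransposition, pPerm_negSwap_mul, flip_negSwap_mul, hp, hx, hy]
    grind -ring -linarith [zero_add, add_zero]
  · have := hoff m
    simp only [pPerm_negSwap_mul, flip_negSwap_mul, mem_insert, mem_singleton] at *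
    grind -ring -linarith [zero_add, add_zero]

theorem card_leftFactors_of_flip (hn : 2 ≤ n) {w : Bgrp 2 n} {x y : Fin n} (hxy : x ≠ y)
    (hp : ∀ i, pPerm 2 n twoPos w.1 i = i) (hx : flip w.1 x = 1) (hy : flip w.1 y = 1)
    (hoff : TrivialOff w.1 {x, y}) : #(leftFactors w) = 2 := by
  classical
  refine card_eq_two.mpr ⟨negSwap x y, negSwap y x,
    fun h => hxy (negSwap_inj hxy h).1, ?_⟩
  ext a
  simp only [mem_insert, mem_singleton]
  constructor
  · intro ha
    obtain ⟨i, j, k, l, hij, hkl, rfl, hw⟩ := (mem_leftFactors hn).mp ha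
    have hp' := fun m => pPerm_negSwap_mul i j m (negSwap k l)
    have hf := fun m => flip_negSwap_mul i j m (negSwap k l)
    simp only [pPerm_negSwap, flip_negSwap, ← hw, hp] at hp' hf
    simp only [TrivialOff, mem_insert, mem_singleton] at hoff
    have h11 : (1 : Fin 2) + 1 = 0 := rfl
    have hkl' : k = i ∧ l = j ∨ k = j ∧ l = i := by
      have := hp' k
      have := hp' l
      grind -ring -linarith [zero_add, add_zero]
    have hkl : k = i ∧ l = j := by
      have := hf x
      grind -ring -linarith [zero_add, add_zero]
    have hi := hoff i
    have hj := hoff j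
    have hi' := hf i
    have hj' := hf j
    have : i = x ∧ j = y ∨ i = y ∧ j = x := by grind -ring -linarith [zero_add, add_zero]
    rcases this with ⟨rfl, rfl⟩ | ⟨rfl, rfl⟩ <;> simp
  · rintro (rfl | rfl)
    · exact negSwap_mem_leftFactors_of_flip hn hxy hp hx hy hoff
    · exact negSwap_mem_leftFactors_of_flip hn hxy.symm hp hy hx (by rwa [pair_comm])

theorem card_leftFactors_one (hn : 2 ≤ n) : #(leftFactors (1 : Bgrp 2 n)) = n * (n - 1) := by
  classical
  have h : leftFactors (1 : Bgrp 2 n) = (univ : Finset (Fin n)).offDiag.image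
      fun q => negSwap q.1 q.2 := by
    ext a
    simp only [mem_image, mem_offDiag, mem_univ, true_and, mem_leftFactors hn, Prod.exists]
    constructor
    · rintro ⟨i, j, k, l, hij, -, rfl, -⟩
      exact ⟨i, j, hij, rfl⟩
    · rintro ⟨i, j, hij, rfl⟩
      exact ⟨i, j, j, i, hij, hij.symm, rfl, (negSwap_mul_negSwap_swap hij).symm⟩
  rw [h, card_image_of_injOn, offDiag_card, card_univ, Fintype.card_fin, Nat.mul_sub_one]
  intro q hq r _ hqr
  have := negSwap_inj (mem_offDiag.mp (mem_coe.mp hq)).2.2 hqr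
  exact Prod.ext this.1 this.2

open scoped Classical in
theorem card_leftFactors (hn : 5 ≤ n) (w : Bgrp 2 n) : #(leftFactors w) =
    (n * (n - 1)) * (if HasBitype w.1 (Multiset.replicate n 1) 0 then 1 else 0) +
    2 * (if HasBitype w.1 (Multiset.replicate (n - 2) 1) {1, 1} then 1 else 0) +
    2 * (if HasBitype w.1 (Multiset.replicate (n - 4) 1) {2, 2} then 1 else 0) +
    3 * (if HasBitype w.1 (Multiset.replicate (n - 3) 1 + {3}) 0 then 1 else 0) := by
  have card_eq {l₁ l₂ m₁ m₂} (h : HasBitype w.1 l₁ l₂) (h' : HasBitype w.1 m₁ m₂) :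
      l₁.card = m₁.card ∧ l₂.card = m₂.card := by
    rw [← h.1, ← h.2, ← h'.1, ← h'.2]
    exact ⟨rfl, rfl⟩
  by_cases h1 : HasBitype w.1 (Multiset.replicate n 1) 0
  · rw [if_pos h1, if_neg, if_neg, if_neg, show w = 1 from Subtype.ext (eq_one_of_hasBitype w.2 h1),
      card_leftFactors_one (by omega)]
    · simp
    all_goals
      intro h
      have := card_eq h1 h
      simp at this
      try omega
  by_cases h2 : HasBitype w.1 (Multiset.replicate (n - 2) 1) {1, 1}
  · obtain ⟨x, y, hxy, hp, hx, hy, hoff⟩ := exists_flip_of_hasBitype w.2 (by omega) h2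
    rw [if_neg h1, if_pos h2, if_neg, if_neg,
      card_leftFactors_of_flip (by omega) hxy hp hx hy hoff]
    · simp
    all_goals
      intro h
      have := card_eq h2 h
      simp at this
      try omega
  by_cases h3 : HasBitype w.1 (Multiset.replicate (n - 4) 1) {2, 2}
  · obtain ⟨x, y, z, u, h, h', hxz, hxu, hyz, hyu, hoff⟩ :=
      exists_isNegTransposition_pair_of_hasBitype w.2 (by omega) h3
    rw [if_neg h1, if_neg h2, if_pos h3, if_neg,
      card_leftFactors_of_isNegTransposition_pair (by omega) h h' hxz hxu hyz hyu hoff]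
    · simp
    intro h
    have := card_eq h3 h
    simp at this
  by_cases h4 : HasBitype w.1 (Multiset.replicate (n - 3) 1 + {3}) 0
  · obtain ⟨x, y, z, h, hoff⟩ := exists_isPosThreeCycle_of_hasBitype w.2 (by omega) h4
    rw [if_neg h1, if_neg h2, if_neg h3, if_pos h4,
      card_leftFactors_of_isPosThreeCycle (by omega) h hoff]
    simp
  rw [if_neg h1, if_neg h2, if_neg h3, if_neg h4, card_eq_zero.mpr]
  · simp
  refine eq_empty_of_forall_notMem fun a ha => ?_
  obtain ⟨i, j, k, l, hij, hkl, -, rfl⟩ := (mem_leftFactors (by omega)).mp ha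
  have := hasBitype_negSwap_mul_negSwap hij hkl
  tauto

open scoped Classical in
theorem CB_eq_sum_ite (l₁ l₂ : Multiset ℕ) : CB n l₁ l₂ =
    ∑ w : Bgrp 2 n, (if HasBitype w.1 l₁ l₂ then (1 : ℂ) else 0) •
      MonoidAlgebra.of ℂ (Bgrp 2 n) w := by
  simp only [CB, ite_smul, one_smul, zero_smul, sum_filter]
  exact sum_congr rfl fun w _ => if_congr Iff.rfl rfl rfl

open scoped Classical in
theorem CB_mul_self : CB n (Multiset.replicate (n - 2) 1) {2} *
    CB n (Multiset.replicate (n - 2) 1) {2} =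
      ∑ w : Bgrp 2 n, (#(leftFactors w) : ℂ) • MonoidAlgebra.of ℂ (Bgrp 2 n) w := by
  have hCB : CB n (Multiset.replicate (n - 2) 1) {2} =
      ∑ w ∈ negSwaps n, MonoidAlgebra.of ℂ (Bgrp 2 n) w := by
    simp only [CB_eq_sum_ite, negSwaps, sum_filter, ite_smul, one_smul, zero_smul]
  have inner (a : Bgrp 2 n) : ∑ b ∈ negSwaps n,
      MonoidAlgebra.of ℂ (Bgrp 2 n) a * MonoidAlgebra.of ℂ (Bgrp 2 n) b =
        ∑ w, if a⁻¹ * w ∈ negSwaps n then MonoidAlgebra.of ℂ (Bgrp 2 n) w else 0 := by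
    rw [← univ.filter_mem_eq_inter.trans (univ_inter (negSwaps n)), sum_filter]
    refine Fintype.sum_equiv (Equiv.mulLeft a) _ _ fun b => ?_
    simp
  rw [hCB, sum_mul_sum, sum_congr rfl fun a _ => inner a, sum_comm]
  refine sum_congr rfl fun w _ => ?_
  rw [← sum_filter, sum_const, Nat.cast_smul_eq_nsmul, leftFactors]

end

/-- In the center of the group algebra of `B_{2n}^2`, for `n ≥ 5`:
`C_{((1^{n-2}),(2))}² = n(n-1) C_{((1^n),∅)} + 2 C_{((1^{n-2}),(1²))}
  + 2 C_{((1^{n-4}),(2²))} + 3 C_{((1^{n-3},3),∅)}`. -/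
theorem classSum_hyperoctahedral (n : ℕ) (hn : 5 ≤ n) :
    CB n (Multiset.replicate (n - 2) 1) {2} * CB n (Multiset.replicate (n - 2) 1) {2} =
      ((n : ℂ) * ((n : ℂ) - 1)) • CB n (Multiset.replicate n 1) 0 +
      (2 : ℂ) • CB n (Multiset.replicate (n - 2) 1) {1, 1} +
      (2 : ℂ) • CB n (Multiset.replicate (n - 4) 1) {2, 2} +
      (3 : ℂ) • CB n (Multiset.replicate (n - 3) 1 + {3}) 0 := by
  have h1 : ((n - 1 : ℕ) : ℂ) = (n : ℂ) - 1 := by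
    rw [Nat.cast_sub (by omega), Nat.cast_one]
  rw [CB_mul_self]
  simp only [CB_eq_sum_ite, smul_sum, smul_smul, ← sum_add_distrib, ← add_smul]
  refine sum_congr rfl fun w _ => ?_
  rw [card_leftFactors hn]
  push_cast
  rw [h1]

end KWr
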